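/- Let P be a standard parabolic submonoid of M satisfying Assumption 1 and let g, g' be two P-ribbons. Then rightlcm(g, g') is a P-ribbon. -/

import Mathlib

/-!
Common setting: Garside monoids, standard parabolic submonoids, heads,
ribbons, following Digne–Michel, "Ribbons in Garside monoids".
-/

namespace GarsidePaper

variable {M : Type*}

/-- `a` left-divides `b` : `b = a * c` for some `c`. -/
def LDvd [Monoid M] (a b : M) : Prop := ∃ c, b = a * c

/-- `a` right-divides `b` : `b = c * a` for some `c`. -/
def RDvd [Monoid M] (a b : M) : Prop := ∃ c, b = c * a

/-- `a` is a factor of `b` : `a` left-divides a right-divisor of `b`. -/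
def IsFactor [Monoid M] (a b : M) : Prop := ∃ c, LDvd a c ∧ RDvd c b

/-- A Garside structure on a (left- and right-) cancellative monoid `M`:
left/right gcds and lcms, Noetherianity, and a Garside element `Δ`. -/
structure GarsideStruct (M : Type*) [CancelMonoid M] where
  /-- left-gcd : gcd for the left-divisibility order -/
  lgcd : M → M → M
  lgcd_dvd_left : ∀ a b, LDvd (lgcd a b) a
  lgcd_dvd_right : ∀ a b, LDvd (lgcd a b) b
  lgcd_greatest : ∀ a b d, LDvd d a → LDvd d b → LDvd d (lgcd a b)
  /-- right-lcm : lcm for the left-divisibility order -/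
  rlcm : M → M → M
  ldvd_rlcm_left : ∀ a b, LDvd a (rlcm a b)
  ldvd_rlcm_right : ∀ a b, LDvd b (rlcm a b)
  rlcm_least : ∀ a b m, LDvd a m → LDvd b m → LDvd (rlcm a b) m
  /-- right-gcd : gcd for the right-divisibility order -/
  rgcd : M → M → M
  rgcd_dvd_left : ∀ a b, RDvd (rgcd a b) a
  rgcd_dvd_right : ∀ a b, RDvd (rgcd a b) b
  rgcd_greatest : ∀ a b d, RDvd d a → RDvd d b → RDvd d (rgcd a b)
  /-- left-lcm : lcm for the right-divisibility order -/
  llcm : M → M → M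
  rdvd_llcm_left : ∀ a b, RDvd a (llcm a b)
  rdvd_llcm_right : ∀ a b, RDvd b (llcm a b)
  llcm_least : ∀ a b m, RDvd a m → RDvd b m → RDvd (llcm a b) m
  /-- Noetherian: no infinite sequence where each term is a proper factor
  of the previous one. -/
  noetherian : WellFounded (fun a b : M => IsFactor a b ∧ a ≠ b)
  /-- the Garside element -/
  Δ : M
  /-- the left- and right-divisors of `Δ` coincide -/
  delta_balanced : ∀ a : M, LDvd a Δ ↔ RDvd a Δ
  /-- the divisors of `Δ` generate `M` -/
  delta_generates : Submonoid.closure {a : M | LDvd a Δ} = ⊤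

variable [CancelMonoid M]

/-- An atom: an element with no proper nontrivial divisor (factor). -/
def IsAtom' (a : M) : Prop := a ≠ 1 ∧ ∀ b : M, IsFactor b a → b = 1 ∨ b = a

/-- A standard parabolic submonoid: a submonoid closed under factors in which
every element of `M` has a maximal left-divisor (the left `P`-head) and a
maximal right-divisor (the right `P`-head) lying in `P`. -/
structure IsStdParabolic (P : Submonoid M) : Prop where
  factor_closed : ∀ a b : M, b ∈ P → IsFactor a b → a ∈ P
  exists_left_head : ∀ g : M, ∃ h, h ∈ P ∧ LDvd h g ∧
    ∀ h', h' ∈ P → LDvd h' g → LDvd h' h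
  exists_right_head : ∀ g : M, ∃ h, h ∈ P ∧ RDvd h g ∧
    ∀ h', h' ∈ P → RDvd h' g → RDvd h' h

/-- `h` is the left `P`-head `H_P g` of `g` : the maximal left-divisor of `g`
lying in `P`. -/
def IsLeftHead (P : Set M) (g h : M) : Prop :=
  h ∈ P ∧ LDvd h g ∧ ∀ h', h' ∈ P → LDvd h' g → LDvd h' h

/-- `h` is the right `P`-head of `g` : the maximal right-divisor of `g`
lying in `P`. -/
def IsRightHead (P : Set M) (g h : M) : Prop :=
  h ∈ P ∧ RDvd h g ∧ ∀ h', h' ∈ P → RDvd h' g → RDvd h' h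

/-- `g` is `P`-reduced : `H_P g = 1`, i.e. the only left-divisor of `g`
lying in `P` is `1`. -/
def PReduced (P : Set M) (g : M) : Prop := ∀ h ∈ P, LDvd h g → h = 1

/-- `P ^ g` is defined: `p ^ g` is defined (`g ≼ p * g`) for every `p ∈ P`. -/
def ConjSetDef (P : Set M) (g : M) : Prop := ∀ p ∈ P, LDvd g (p * g)

/-- The set `P ^ g = { p ^ g : p ∈ P }`, where `p ^ g` is the unique `c`
with `p * g = g * c`. -/
def conjSet (P : Set M) (g : M) : Set M := {c : M | ∃ p ∈ P, p * g = g * c}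

/-- A `P`-ribbon: a `P`-reduced element `g` such that `P ^ g` is defined. -/
def IsRibbon (P : Set M) (g : M) : Prop := PReduced P g ∧ ConjSetDef P g

/-- `P` is the smallest standard parabolic submonoid containing `S₁`. -/
def IsSmallestParabolicContaining (S₁ : Set M) (P : Submonoid M) : Prop :=
  IsStdParabolic P ∧ S₁ ⊆ (P : Set M) ∧
    ∀ Q : Submonoid M, IsStdParabolic Q → S₁ ⊆ (Q : Set M) → P ≤ Q

/-- Assumption 1: for any set `S₁` of atoms, the right-lcm of `S₁` is the
Garside element `Δ_{P₁} = H_{P₁}(Δ)` of the smallest standard parabolic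
submonoid `P₁` containing `S₁`. -/
def Assumption1 (G : GarsideStruct M) : Prop :=
  ∀ S₁ : Set M, (∀ s ∈ S₁, IsAtom' s) →
    ∀ P₁ : Submonoid M, IsSmallestParabolicContaining S₁ P₁ →
      ∀ d : M, IsLeftHead (P₁ : Set M) G.Δ d →
        (∀ s ∈ S₁, LDvd s d) ∧ ∀ m : M, (∀ s ∈ S₁, LDvd s m) → LDvd d m

/-- Assumption 2: some (positive) power of `Δ` is central. -/
def Assumption2 (G : GarsideStruct M) : Prop :=
  ∃ n : ℕ, 0 < n ∧ ∀ x : M, G.Δ ^ n * x = x * G.Δ ^ n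

/-- `v = v_{s,P}` : the element defined by `Δ_{P_s} = Δ_P * v`, where `P_s`
is the smallest standard parabolic submonoid containing `P` and `s`. -/
def IsVsp (G : GarsideStruct M) (P : Submonoid M) (s v : M) : Prop :=
  ∃ Ps : Submonoid M, IsSmallestParabolicContaining ((P : Set M) ∪ {s}) Ps ∧
    ∃ dP dPs : M, IsLeftHead (P : Set M) G.Δ dP ∧
      IsLeftHead (Ps : Set M) G.Δ dPs ∧ dPs = dP * v

theorem LDvd.trans {a b c : M} (h : LDvd a b) (h' : LDvd b c) : LDvd a c := by
  obtain ⟨x, rfl⟩ := h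
  obtain ⟨y, rfl⟩ := h'
  exact ⟨x * y, mul_assoc _ _ _⟩

theorem RDvd.trans {a b c : M} (h : RDvd a b) (h' : RDvd b c) : RDvd a c := by
  obtain ⟨x, rfl⟩ := h
  obtain ⟨y, rfl⟩ := h'
  exact ⟨y * x, (mul_assoc _ _ _).symm⟩

theorem LDvd.refl (a : M) : LDvd a a := ⟨1, (mul_one a).symm⟩

theorem RDvd.refl (a : M) : RDvd a a := ⟨1, (one_mul a).symm⟩

theorem LDvd.mul_left {a b : M} (h : LDvd a b) (c : M) : LDvd (c * a) (c * b) := by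
  obtain ⟨x, rfl⟩ := h
  exact ⟨x, (mul_assoc _ _ _).symm⟩

theorem LDvd.of_mul_left {a b c : M} (h : LDvd (c * a) (c * b)) : LDvd a b := by
  obtain ⟨x, hx⟩ := h
  exact ⟨x, mul_left_cancel (hx.trans (mul_assoc _ _ _))⟩

theorem LDvd.isFactor {a b : M} (h : LDvd a b) : IsFactor a b := ⟨b, h, RDvd.refl b⟩

theorem RDvd.isFactor {a b : M} (h : RDvd a b) : IsFactor a b := ⟨a, LDvd.refl a, h⟩

theorem isFactor_iff {a b : M} : IsFactor a b ↔ ∃ u w, b = u * a * w := by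
  constructor
  · rintro ⟨_, ⟨w, rfl⟩, u, rfl⟩
    exact ⟨u, w, (mul_assoc _ _ _).symm⟩
  · rintro ⟨u, w, rfl⟩
    exact ⟨a * w, ⟨w, rfl⟩, u, mul_assoc _ _ _⟩

theorem GarsideStruct.isFactor_antisymm (G : GarsideStruct M) {a b : M} (h : IsFactor a b)
    (h' : IsFactor b a) : a = b := by
  by_contra hne
  exact G.noetherian.asymmetric a b ⟨h, hne⟩ ⟨h', Ne.symm hne⟩

theorem GarsideStruct.eq_one_of_mul_eq_one (G : GarsideStruct M) {a b : M} (h : a * b = 1) :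
    a = 1 :=
  G.isFactor_antisymm (LDvd.isFactor ⟨b, h.symm⟩) (LDvd.isFactor ⟨a, (one_mul a).symm⟩)

theorem GarsideStruct.exists_atom_ldvd (G : GarsideStruct M) {g : M} (hg : g ≠ 1) :
    ∃ t, IsAtom' t ∧ LDvd t g := by
  obtain ⟨x, ⟨hx1, hxg⟩, hmin⟩ :=
    G.noetherian.has_min {x | x ≠ 1 ∧ LDvd x g} ⟨g, hg, LDvd.refl g⟩
  have key : ∀ b, LDvd b x → b = 1 ∨ b = x := by
    intro b hb
    by_contra! hne
    exact hmin b ⟨hne.1, hb.trans hxg⟩ ⟨hb.isFactor, hne.2⟩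
  refine ⟨x, ⟨hx1, fun b hb => ?_⟩, hxg⟩
  obtain ⟨u, w, h⟩ := isFactor_iff.1 hb
  rw [mul_assoc] at h
  rcases key u ⟨_, h⟩ with rfl | rfl
  · exact key b ⟨w, by simpa using h⟩
  · exact Or.inl (G.eq_one_of_mul_eq_one (left_eq_mul.1 h))

/-- In a Noetherian Garside monoid, a factor-closed submonoid is generated by its atoms. -/
theorem GarsideStruct.induction_atoms (G : GarsideStruct M) {P : Submonoid M}
    (hP : ∀ a b : M, b ∈ P → IsFactor a b → a ∈ P) {C : M → Prop} (one : C 1)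
    (mul : ∀ a ∈ P, ∀ b ∈ P, IsAtom' a → C b → C (a * b)) : ∀ x ∈ P, C x := by
  intro x
  induction x using G.noetherian.induction with
  | _ x ih =>
    intro hx
    by_cases h1 : x = 1
    · exact h1 ▸ one
    obtain ⟨a, ha, y, rfl⟩ := G.exists_atom_ldvd h1
    have hf : IsFactor y (a * y) := RDvd.isFactor ⟨a, rfl⟩
    have hy := hP _ _ hx hf
    refine mul a (hP _ _ hx (LDvd.isFactor ⟨y, rfl⟩)) y hy ha (ih y ⟨hf, fun h => ?_⟩ hy)
    exact ha.1 (right_eq_mul.1 h)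

theorem GarsideStruct.isSmallest_atoms (G : GarsideStruct M) {P : Submonoid M}
    (hP : IsStdParabolic P) :
    IsSmallestParabolicContaining {s | s ∈ P ∧ IsAtom' s} P :=
  ⟨hP, fun _ h => h.1, fun Q _ hS => G.induction_atoms hP.factor_closed Q.one_mem
    fun _ ha _ _ hat hb => Q.mul_mem (hS ⟨ha, hat⟩) hb⟩

theorem GarsideStruct.exists_smallest (G : GarsideStruct M) (S₁ : Set M) :
    ∃ R : Submonoid M, IsSmallestParabolicContaining S₁ R := by
  refine ⟨sInf {Q | IsStdParabolic Q ∧ S₁ ⊆ (Q : Set M)}, ⟨?_, ?_, ?_⟩, ?_, ?_⟩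
  · intro a b hb hab
    rw [Submonoid.mem_sInf] at hb ⊢
    exact fun Q hQ => hQ.1.factor_closed a b (hb Q hQ) hab
  · intro g
    obtain ⟨x, ⟨hxg, hx⟩, hmin⟩ := G.noetherian.has_min
      {x | LDvd x g ∧ ∀ h' ∈ sInf {Q | IsStdParabolic Q ∧ S₁ ⊆ (Q : Set M)}, LDvd h' g → LDvd h' x}
      ⟨g, LDvd.refl g, fun _ _ h => h⟩
    refine ⟨x, Submonoid.mem_sInf.2 fun Q hQ => ?_, hxg, hx⟩
    obtain ⟨h, hhQ, hhx, hh⟩ := hQ.1.exists_left_head x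
    by_contra hxQ
    exact hmin h ⟨hhx.trans hxg, fun h' hh' hg =>
        hh h' (Submonoid.mem_sInf.1 hh' Q hQ) (hx h' hh' hg)⟩
      ⟨hhx.isFactor, fun e => hxQ (e ▸ hhQ)⟩
  · intro g
    obtain ⟨x, ⟨hxg, hx⟩, hmin⟩ := G.noetherian.has_min
      {x | RDvd x g ∧ ∀ h' ∈ sInf {Q | IsStdParabolic Q ∧ S₁ ⊆ (Q : Set M)}, RDvd h' g → RDvd h' x}
      ⟨g, RDvd.refl g, fun _ _ h => h⟩
    refine ⟨x, Submonoid.mem_sInf.2 fun Q hQ => ?_, hxg, hx⟩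
    obtain ⟨h, hhQ, hhx, hh⟩ := hQ.1.exists_right_head x
    by_contra hxQ
    exact hmin h ⟨hhx.trans hxg, fun h' hh' hg =>
        hh h' (Submonoid.mem_sInf.1 hh' Q hQ) (hx h' hh' hg)⟩
      ⟨hhx.isFactor, fun e => hxQ (e ▸ hhQ)⟩
  · intro s hs
    exact Submonoid.mem_sInf.2 fun Q hQ => hQ.2 hs
  · exact fun Q hQ hS => sInf_le ⟨hQ, hS⟩

theorem IsStdParabolic.ldvd_mem {P : Submonoid M} (hP : IsStdParabolic P) {a b : M} (hb : b ∈ P)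
    (h : LDvd a b) : a ∈ P :=
  hP.factor_closed a b hb h.isFactor

theorem IsStdParabolic.rdvd_mem {P : Submonoid M} (hP : IsStdParabolic P) {a b : M} (hb : b ∈ P)
    (h : RDvd a b) : a ∈ P :=
  hP.factor_closed a b hb h.isFactor

/-- The element `Δ_P` has the same left- and right-divisors. -/
theorem GarsideStruct.head_balanced (G : GarsideStruct M) {P : Submonoid M}
    (hP : IsStdParabolic P) {d : M} (hd : IsLeftHead (P : Set M) G.Δ d) (a : M) :
    LDvd a d ↔ RDvd a d := by
  obtain ⟨hdP, hdΔ, hmax⟩ := hd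
  obtain ⟨d', hd'P, hΔr, hmax'⟩ := hP.exists_right_head G.Δ
  have h1 : LDvd d' d := hmax d' hd'P ((G.delta_balanced _).2 hΔr)
  have h2 : RDvd d d' := hmax' d hdP ((G.delta_balanced _).1 hdΔ)
  obtain rfl : d' = d := G.isFactor_antisymm h1.isFactor h2.isFactor
  exact ⟨fun h => hmax' a (hP.ldvd_mem hdP h) ((G.delta_balanced _).1 (h.trans hdΔ)),
    fun h => hmax a (hP.rdvd_mem hdP h) ((G.delta_balanced _).2 (h.trans hΔr))⟩

/-- `D ∈ R` normalizes `R`: conjugation by `D` is an automorphism of `R`. -/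
structure Normalizes (R : Submonoid M) (D : M) : Prop where
  mem : D ∈ R
  conj : ∀ p ∈ R, ∃ q ∈ R, p * D = D * q
  conj_inv : ∀ q ∈ R, ∃ p ∈ R, p * D = D * q

theorem Assumption1.normalizes {G : GarsideStruct M} (hA : Assumption1 G) {P : Submonoid M}
    (hP : IsStdParabolic P) {d : M} (hd : IsLeftHead (P : Set M) G.Δ d) : Normalizes P d := by
  have hlcm := (hA _ (fun _ h => h.2) P (G.isSmallest_atoms hP) d hd).1
  have bal := G.head_balanced hP hd
  refine ⟨hd.1, ?_, ?_⟩
  · refine G.induction_atoms hP.factor_closed ⟨1, P.one_mem, by simp⟩ ?_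
    rintro a ha b - hat ⟨q, hq, hbq⟩
    obtain ⟨x, hx⟩ := hlcm a ⟨ha, hat⟩
    obtain ⟨c, hc⟩ := (bal x).2 ⟨a, hx⟩
    have hcP : c ∈ P := hP.rdvd_mem hd.1 ⟨x, hc⟩
    refine ⟨c * q, P.mul_mem hcP hq, ?_⟩
    have : a * d = d * c := by
      conv_lhs => rw [hc]
      rw [← mul_assoc, ← hx]
    rw [mul_assoc, hbq, ← mul_assoc, this, mul_assoc]
  · refine G.induction_atoms hP.factor_closed ⟨1, P.one_mem, by simp⟩ ?_
    rintro a ha b - hat ⟨p, hp, hbp⟩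
    obtain ⟨x, hx⟩ := (bal a).1 (hlcm a ⟨ha, hat⟩)
    obtain ⟨c, hc⟩ := (bal x).1 ⟨a, hx⟩
    have hcP : c ∈ P := hP.ldvd_mem hd.1 ⟨x, hc⟩
    refine ⟨c * p, P.mul_mem hcP hp, ?_⟩
    have : c * d = d * a := by
      conv_lhs => rw [hx]
      rw [← mul_assoc, ← hc]
    rw [mul_assoc, hbp, ← mul_assoc, this, mul_assoc]

/-- The submonoid `P ^ D`. -/
def conjSubmonoid (P : Submonoid M) (D : M) : Submonoid M where
  carrier := conjSet (P : Set M) D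
  one_mem' := ⟨1, P.one_mem, by simp⟩
  mul_mem' := by
    rintro a b ⟨p, hp, ha⟩ ⟨q, hq, hb⟩
    exact ⟨p * q, P.mul_mem hp hq, by rw [mul_assoc, hb, ← mul_assoc, ha, mul_assoc]⟩

theorem mul_conj {D p q p' q' : M} (h : p * D = D * q) (h' : p' * D = D * q') :
    p * p' * D = D * (q * q') := by
  rw [mul_assoc, h', ← mul_assoc, h, mul_assoc]

theorem conj_right_unique {D p q q' : M} (h : p * D = D * q) (h' : p * D = D * q') : q = q' :=
  mul_left_cancel (h.symm.trans h')

theorem conj_left_unique {D p p' q : M} (h : p * D = D * q) (h' : p' * D = D * q) : p = p' :=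
  mul_right_cancel (h.trans h'.symm)

theorem Normalizes.conjSubmonoid_le {R P : Submonoid M} {D : M} (hD : Normalizes R D)
    (hPR : P ≤ R) : conjSubmonoid P D ≤ R := by
  rintro q ⟨p, hp, h⟩
  obtain ⟨q', hq', h'⟩ := hD.conj p (hPR hp)
  exact conj_right_unique h h' ▸ hq'

theorem Normalizes.isStdParabolic_conj {R P : Submonoid M} {D : M} (hD : Normalizes R D)
    (hR : IsStdParabolic R) (hP : IsStdParabolic P) (hPR : P ≤ R) :
    IsStdParabolic (conjSubmonoid P D) := by
  have hle := hD.conjSubmonoid_le hPR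
  refine ⟨?_, ?_, ?_⟩
  · intro a b hb hab
    have hbR := hle hb
    obtain ⟨u, w, rfl⟩ := isFactor_iff.1 hab
    obtain ⟨p, hp, hpb⟩ := hb
    obtain ⟨a', -, ha⟩ := hD.conj_inv a (hR.factor_closed _ _ hbR hab)
    obtain ⟨u', -, hu⟩ := hD.conj_inv u (hR.ldvd_mem hbR ⟨a * w, mul_assoc _ _ _⟩)
    obtain ⟨w', -, hw⟩ := hD.conj_inv w (hR.rdvd_mem hbR ⟨_, rfl⟩)
    have := conj_left_unique hpb (mul_conj (mul_conj hu ha) hw)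
    exact ⟨a', hP.factor_closed _ p hp (isFactor_iff.2 ⟨u', w', this⟩), ha⟩
  · intro x
    obtain ⟨y, hy, hyx, hymax⟩ := hR.exists_left_head x
    obtain ⟨y', hy', hyc⟩ := hD.conj_inv y hy
    obtain ⟨z', hz', ⟨w', rfl⟩, hzmax⟩ := hP.exists_left_head y'
    obtain ⟨z, -, hzc⟩ := hD.conj z' (hPR hz')
    obtain ⟨w, -, hwc⟩ := hD.conj w' (hR.rdvd_mem hy' ⟨_, rfl⟩)
    refine ⟨z, ⟨z', hz', hzc⟩,
      LDvd.trans ⟨w, conj_right_unique hyc (mul_conj hzc hwc)⟩ hyx, ?_⟩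
    intro q hq hqx
    obtain ⟨r, rfl⟩ := hymax q (hle hq) hqx
    obtain ⟨r', -, hrc⟩ := hD.conj_inv r (hR.rdvd_mem hy ⟨_, rfl⟩)
    obtain ⟨q', hq', hqc⟩ := hq
    obtain ⟨e', rfl⟩ := hzmax q' hq' ⟨r', conj_left_unique hyc (mul_conj hqc hrc)⟩
    obtain ⟨e, -, hec⟩ := hD.conj e' (hR.rdvd_mem (hPR hz') ⟨_, rfl⟩)
    exact ⟨e, conj_right_unique hzc (mul_conj hqc hec)⟩
  · intro x
    obtain ⟨y, hy, hyx, hymax⟩ := hR.exists_right_head x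
    obtain ⟨y', hy', hyc⟩ := hD.conj_inv y hy
    obtain ⟨z', hz', ⟨w', rfl⟩, hzmax⟩ := hP.exists_right_head y'
    obtain ⟨z, -, hzc⟩ := hD.conj z' (hPR hz')
    obtain ⟨w, -, hwc⟩ := hD.conj w' (hR.ldvd_mem hy' ⟨_, rfl⟩)
    refine ⟨z, ⟨z', hz', hzc⟩,
      RDvd.trans ⟨w, conj_right_unique hyc (mul_conj hwc hzc)⟩ hyx, ?_⟩
    intro q hq hqx
    obtain ⟨r, rfl⟩ := hymax q (hle hq) hqx
    obtain ⟨r', -, hrc⟩ := hD.conj_inv r (hR.ldvd_mem hy ⟨_, rfl⟩)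
    obtain ⟨q', hq', hqc⟩ := hq
    obtain ⟨e', rfl⟩ := hzmax q' hq' ⟨r', conj_left_unique hyc (mul_conj hrc hqc)⟩
    obtain ⟨e, -, hec⟩ := hD.conj e' (hR.ldvd_mem (hPR hz') ⟨_, rfl⟩)
    exact ⟨e, conj_right_unique hzc (mul_conj hec hqc)⟩

/-- Conjugation by `Δ_R` sends `Δ_P` to `Δ_{P ^ Δ_R}`. -/
theorem Normalizes.isLeftHead_conj {R P : Submonoid M} {D Δ d e : M} (hN : Normalizes R D)
    (hR : IsStdParabolic R) (hPR : P ≤ R) (hD : IsLeftHead (R : Set M) Δ D)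
    (hd : IsLeftHead (P : Set M) Δ d) (he : d * D = D * e) :
    IsLeftHead (conjSubmonoid P D : Set M) Δ e := by
  have hsplit : ∀ {a b a' b' : M}, a * D = D * a' → b * D = D * b' → (a * b = D ↔ a' * b' = D) := by
    intro a b a' b' ha hb
    constructor
    · intro h
      exact (conj_right_unique (by rw [h]) (mul_conj ha hb)).symm
    · intro h
      exact (conj_left_unique (by rw [h]) (mul_conj ha hb)).symm
  refine ⟨⟨d, hd.1, he⟩, ?_, ?_⟩
  · obtain ⟨v, hv⟩ := hD.2.2 d (hPR hd.1) hd.2.1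
    obtain ⟨v', -, hvc⟩ := hN.conj v (hR.rdvd_mem hD.1 ⟨d, hv⟩)
    exact LDvd.trans ⟨v', ((hsplit he hvc).1 hv.symm).symm⟩ hD.2.1
  · intro q hq hqΔ
    obtain ⟨r, hr⟩ := hD.2.2 q (hN.conjSubmonoid_le hPR hq) hqΔ
    obtain ⟨r', -, hrc⟩ := hN.conj_inv r (hR.rdvd_mem hD.1 ⟨q, hr⟩)
    obtain ⟨q', hq', hqc⟩ := hq
    obtain ⟨f, rfl⟩ := hd.2.2 q' hq'
      (LDvd.trans ⟨r', ((hsplit hqc hrc).2 hr.symm).symm⟩ hD.2.1)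
    obtain ⟨f', -, hfc⟩ := hN.conj f (hR.rdvd_mem (hPR hd.1) ⟨_, rfl⟩)
    exact ⟨f', conj_right_unique he (mul_conj hqc hfc)⟩

/-- For an atom `t`, the right-lcm of `Δ_P` and `t` is `Δ_R = Δ_P * v` for some standard
parabolic `R` containing `P` and `t`. -/
theorem Assumption1.exists_parabolic_insert {G : GarsideStruct M} (hA : Assumption1 G)
    {P : Submonoid M} (hP : IsStdParabolic P) {d : M} (hd : IsLeftHead (P : Set M) G.Δ d)
    {t : M} (ht : IsAtom' t) :
    ∃ (R : Submonoid M) (v : M), IsStdParabolic R ∧ P ≤ R ∧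
      IsLeftHead (R : Set M) G.Δ (d * v) ∧ LDvd t (d * v) ∧
      ∀ m, LDvd d m → LDvd t m → LDvd (d * v) m := by
  have hlcm := (hA _ (fun _ h => h.2) P (G.isSmallest_atoms hP) d hd).1
  obtain ⟨R, hR⟩ := G.exists_smallest (insert t {s | s ∈ P ∧ IsAtom' s})
  obtain ⟨D, hD⟩ := hR.1.exists_left_head G.Δ
  have hPR : P ≤ R := (G.isSmallest_atoms hP).2.2 R hR.1
    ((Set.subset_insert _ _).trans hR.2.1)
  obtain ⟨v, rfl⟩ := hD.2.2 d (hPR hd.1) hd.2.1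
  have hat : ∀ s ∈ insert t {s | s ∈ P ∧ IsAtom' s}, IsAtom' s := by
    rintro s (rfl | hs)
    exacts [ht, hs.2]
  obtain ⟨h1, h2⟩ := hA _ hat R hR _ hD
  refine ⟨R, v, hR.1, hPR, hD, h1 t (Set.mem_insert _ _), fun m hdm htm => h2 m ?_⟩
  rintro s (rfl | hs)
  exacts [htm, (hlcm s hs).trans hdm]

/-- A `P`-reduced element `g` such that `Δ_P ^ g` is defined satisfies
`Δ_P * g = rightlcm(Δ_P, g)`. -/
theorem Assumption1.head_mul_ldvd {G : GarsideStruct M} (hA : Assumption1 G) (g : M) :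
    ∀ (P : Submonoid M), IsStdParabolic P → ∀ d, IsLeftHead (P : Set M) G.Δ d →
      PReduced (P : Set M) g → LDvd g (d * g) →
      ∀ m, LDvd d m → LDvd g m → LDvd (d * g) m := by
  induction g using G.noetherian.induction with
  | _ g ih =>
    intro P hP d hd hred hgd
    by_cases hg1 : g = 1
    · subst hg1
      exact fun m hm _ => by rwa [mul_one]
    obtain ⟨t, ht, htg⟩ := G.exists_atom_ldvd hg1
    obtain ⟨R, v, hR, hPR, hD, htD, hlcm⟩ := hA.exists_parabolic_insert hP hd ht
    obtain ⟨x, rfl⟩ := (hlcm _ ⟨g, rfl⟩ (htg.trans hgd)).of_mul_left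
    have hv1 : v ≠ 1 := by
      rintro rfl
      rw [mul_one] at htD
      exact ht.1 (hred t (hP.ldvd_mem hd.1 htD) htg)
    have hNR := hA.normalizes hR hD
    have hNP := hA.normalizes hP hd
    have conj_v : ∀ {p p' q : M}, p * d = d * p' → p * (d * v) = d * v * q → p' * v = v * q := by
      intro p p' q h h'
      apply mul_left_cancel (a := d)
      rw [← mul_assoc, ← h, mul_assoc, h', mul_assoc]
    obtain ⟨e, -, he⟩ := hNR.conj d (hPR hd.1)
    have hde : d * v = v * e := conj_v rfl he
    have hfac : IsFactor x (v * x) := RDvd.isFactor ⟨v, rfl⟩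
    have hmin := ih x ⟨hfac, fun h => hv1 (right_eq_mul.1 h)⟩
      (conjSubmonoid P (d * v)) (hNR.isStdParabolic_conj hR hP hPR) e
      (hNR.isLeftHead_conj hR hPR hD hd he) ?_ ?_
    · intro m hdm hgm
      have h := hlcm m hdm (htg.trans hgm)
      obtain ⟨y, rfl⟩ := hgm
      rw [mul_assoc, hde] at h
      have := (hmin _ (LDvd.of_mul_left h) ⟨y, rfl⟩).mul_left v
      rwa [← mul_assoc v e, ← hde, mul_assoc d, ← mul_assoc v] at this
    · rintro q ⟨p, hp, hq⟩ ⟨y, rfl⟩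
      obtain ⟨p', hp', hpp⟩ := hNP.conj p hp
      have h := conj_v hpp hq
      have : p' = 1 := hred p' hp' ⟨v * y, by rw [← mul_assoc, ← mul_assoc, h]⟩
      rw [this, one_mul] at h
      exact left_eq_mul.1 h
    · rw [← mul_assoc, hde, mul_assoc] at hgd
      exact hgd.of_mul_left

/-- For a `P`-ribbon `g` and `p ≼ Δ_P`, one has `p * g = rightlcm(p, g)`. -/
theorem Assumption1.mul_ribbon_ldvd {G : GarsideStruct M} (hA : Assumption1 G) {P : Submonoid M}
    (hP : IsStdParabolic P) {d : M} (hd : IsLeftHead (P : Set M) G.Δ d) {g : M}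
    (hg : IsRibbon (P : Set M) g) {p : M} (hp : LDvd p d) {m : M} (hpm : LDvd p m)
    (hgm : LDvd g m) : LDvd (p * g) m := by
  obtain ⟨r, rfl⟩ := (G.head_balanced hP hd p).1 hp
  have h := hA.head_mul_ldvd g P hP _ hd hg.1 (hg.2 _ hd.1) (r * m) (hpm.mul_left r)
    ((hg.2 r (hP.ldvd_mem hd.1 ⟨p, rfl⟩)).trans (hgm.mul_left r))
  rw [mul_assoc] at h
  exact h.of_mul_left

/-- if `g` and `g'` are `P`-ribbons, so is `rightlcm(g, g')`. -/
theorem statement12 (G : GarsideStruct M) (hA : Assumption1 G)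
    (P : Submonoid M) (hP : IsStdParabolic P)
    (g g' : M) (hg : IsRibbon (P : Set M) g) (hg' : IsRibbon (P : Set M) g') :
    IsRibbon (P : Set M) (G.rlcm g g') := by
  refine ⟨fun h hhP hhL => ?_, fun p hp => G.rlcm_least _ _ _
    ((hg.2 p hp).trans ((G.ldvd_rlcm_left g g').mul_left p))
    ((hg'.2 p hp).trans ((G.ldvd_rlcm_right g g').mul_left p))⟩
  by_contra hh1
  obtain ⟨s, hs, hsh⟩ := G.exists_atom_ldvd hh1
  obtain ⟨d, hd⟩ := hP.exists_left_head G.Δ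
  have hsd : LDvd s d := (hA _ (fun _ h => h.2) P (G.isSmallest_atoms hP) d hd).1 s
    ⟨hP.ldvd_mem hhP hsh, hs⟩
  have hsL := hsh.trans hhL
  have h1 := hA.mul_ribbon_ldvd hP hd hg hsd hsL (G.ldvd_rlcm_left g g')
  have h2 := hA.mul_ribbon_ldvd hP hd hg' hsd hsL (G.ldvd_rlcm_right g g')
  obtain ⟨y, hy⟩ := hsL
  have h3 : LDvd (s * G.rlcm g g') (G.rlcm g g') := by
    rw [hy] at h1 h2
    have := (G.rlcm_least _ _ _ h1.of_mul_left h2.of_mul_left).mul_left s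
    rwa [← hy] at this
  exact hs.1 (right_eq_mul.1 (G.isFactor_antisymm (RDvd.isFactor ⟨s, rfl⟩) h3.isFactor))

end GarsidePaper
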